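/- arXiv:1412.6687 — 10 statements merged into one kernel-verified Lean document; each statement's English description precedes it below -/
import Mathlib

section
/- For each fixed y ≥ 0, the target node's utility x ↦ U_T(x,y) = log₂(x/Δ)/(T_AJ + y + x/2) is strictly concave on the interval [2Δ, x′] and strictly decreasing on [x′, ∞), where x′ is the unique real number x > e·Δ satisfying x·log(x/(e·Δ)) = 2·(T_AJ + y). -/
/-- Capacity of the timing channel: `C(x,y) = log₂(x/Δ)/(T_AJ + y + x/2)`. -/
noncomputable def Cap (Δ T_AJ x y : ℝ) : ℝ := Real.logb 2 (x / Δ) / (T_AJ + y + x / 2)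

/-- The numerator of the derivative of the capacity, up to a positive factor. -/
noncomputable def capSlope (Δ A x : ℝ) : ℝ := A / x + 1 / 2 - Real.log (x / Δ) / 2

theorem capSlope_strictAntiOn {Δ A : ℝ} (hΔ : 0 < Δ) (hA : 0 < A) :
    StrictAntiOn (capSlope Δ A) (Set.Ioi 0) := by
  intro a ha b hb hab
  have ha : 0 < a := ha
  have h1 : A / b < A / a := div_lt_div_of_pos_left hA ha hab
  have h2 : Real.log (a / Δ) < Real.log (b / Δ) :=
    Real.log_lt_log (by positivity) (div_lt_div_of_pos_right hab hΔ)
  unfold capSlope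
  linarith

theorem capSlope_eq_zero {Δ A x : ℝ} (hΔ : 0 < Δ) (hx : 0 < x)
    (h : x * Real.log (x / (Real.exp 1 * Δ)) = 2 * A) : capSlope Δ A x = 0 := by
  have hlog : Real.log (x / (Real.exp 1 * Δ)) = Real.log (x / Δ) - 1 := by
    rw [mul_comm, ← div_div, Real.log_div (by positivity) (by positivity), Real.log_exp]
  rw [hlog] at h
  unfold capSlope
  field_simp
  linarith

theorem hasDerivAt_Cap {Δ T y x : ℝ} (hΔ : 0 < Δ) (hA : 0 < T + y) (hx : 0 < x) :
    HasDerivAt (fun x => Cap Δ T x y)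
      (capSlope Δ (T + y) x * (Real.log 2 * (T + y + x / 2) ^ 2)⁻¹) x := by
  have hlog2 : Real.log 2 ≠ 0 := (Real.log_pos one_lt_two).ne'
  have hD : T + y + x / 2 ≠ 0 := by positivity
  have hnum : HasDerivAt (fun x => Real.logb 2 (x / Δ)) (1 / Δ / (x / Δ) / Real.log 2) x :=
    (((hasDerivAt_id x).div_const Δ).log (by simp; constructor <;> positivity)).div_const _
  have hden : HasDerivAt (fun x : ℝ => T + y + x / 2) (1 / 2) x :=
    ((hasDerivAt_id x).div_const 2).const_add _
  refine (hnum.fun_div hden hD).congr_deriv ?_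
  simp only [capSlope, Real.logb]
  field_simp

/-- for each fixed `y ≥ 0`, the target node's utility
`x ↦ U_T(x,y) = log₂(x/Δ)/(T_AJ + y + x/2)` is strictly concave on `[2Δ, x']` and
strictly decreasing on `[x', ∞)`, where `x'` is the unique real `x > e·Δ` with
`x·log(x/(e·Δ)) = 2·(T_AJ + y)`. -/
theorem stmt_0 (Δ T_AJ P c_T y x' : ℝ)
    (hΔ : 0 < Δ) (hT : 0 < T_AJ) (hP : 0 < P) (hc : 0 < c_T) (hy : 0 ≤ y)
    (hx' : Real.exp 1 * Δ < x')
    (hx'eq : x' * Real.log (x' / (Real.exp 1 * Δ)) = 2 * (T_AJ + y))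
    (hx'uniq : ∀ z : ℝ, Real.exp 1 * Δ < z →
      z * Real.log (z / (Real.exp 1 * Δ)) = 2 * (T_AJ + y) → z = x') :
    StrictConcaveOn ℝ (Set.Icc (2 * Δ) x') (fun x => Cap Δ T_AJ x y) ∧
    StrictAntiOn (fun x => Cap Δ T_AJ x y) (Set.Ici x') := by
  have hA : 0 < T_AJ + y := by positivity
  have hx'pos : 0 < x' := lt_trans (by positivity) hx'
  have hanti := capSlope_strictAntiOn hΔ hA
  have hzero := capSlope_eq_zero hΔ hx'pos hx'eq
  have hlog2 : 0 < Real.log 2 := Real.log_pos one_lt_two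
  have hderiv {x : ℝ} (hx : 0 < x) := hasDerivAt_Cap hΔ hA hx
  constructor
  · refine StrictAntiOn.strictConcaveOn_of_deriv (convex_Icc _ _)
      (fun x hx => (hderiv (by linarith [hx.1])).continuousAt.continuousWithinAt) ?_
    rw [interior_Icc]
    intro a ha b hb hab
    have ha0 : 0 < a := by linarith [ha.1]
    have hb0 : 0 < b := ha0.trans hab
    rw [(hderiv ha0).deriv, (hderiv hb0).deriv]
    have hslope := hanti ha0 hb0 hab
    have hb_pos : 0 < capSlope Δ (T_AJ + y) b := hzero ▸ hanti hb0 hx'pos hb.2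
    have hinv : (Real.log 2 * (T_AJ + y + b / 2) ^ 2)⁻¹ ≤
        (Real.log 2 * (T_AJ + y + a / 2) ^ 2)⁻¹ := by gcongr
    exact mul_lt_mul hslope hinv (by positivity) (hb_pos.trans hslope).le
  · refine strictAntiOn_of_deriv_neg (convex_Ici _)
      (fun x hx => (hderiv (hx'pos.trans_le hx)).continuousAt.continuousWithinAt) ?_
    rw [interior_Ici]
    intro x hx
    have hx0 : 0 < x := hx'pos.trans hx
    rw [(hderiv hx0).deriv]
    exact mul_neg_of_neg_of_pos (hzero ▸ hanti hx'pos hx0 hx) (by positivity)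
end

section
/- For each y ≥ 0: (i) there exists a unique x* > e·Δ satisfying x*·log(x*/(e·Δ)) = 2·(T_AJ + y); (ii) x* > 2Δ; and (iii) x* is the unique maximizer of x ↦ C(x,y) = log₂(x/Δ)/(T_AJ + y + x/2) over [2Δ, ∞). (This x* is the best response b_T(y) of the target node.) -/
/-- The function `z ↦ z * log (z / c)` is strictly increasing on `(c, ∞)`. -/
theorem strictMonoOn_mul_log_div {c : ℝ} (hc : 0 < c) :
    StrictMonoOn (fun z : ℝ => z * Real.log (z / c)) (Set.Ioi c) := by
  intro z hz w hw hzw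
  simp only [Set.mem_Ioi] at hz hw
  have hz0 : 0 < z := hc.trans hz
  have hlog_pos : 0 < Real.log (z / c) := Real.log_pos ((one_lt_div hc).2 hz)
  have hlog_lt : Real.log (z / c) < Real.log (w / c) :=
    Real.log_lt_log (div_pos hz0 hc) (by gcongr)
  exact mul_lt_mul'' hzw hlog_lt hz0.le hlog_pos.le

/-- The function `z ↦ z * log (z / c)` attains every positive value on `(c, ∞)`. -/
theorem exists_mul_log_div_eq {c b : ℝ} (hc : 0 < c) (hb : 0 < b) :
    ∃ x, c < x ∧ x * Real.log (x / c) = b := by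
  have he : 1 < Real.exp 1 := Real.one_lt_exp_iff.2 one_pos
  set M := Real.exp 1 * c + b with hM
  have hcM : c ≤ M := by nlinarith
  have hcont : ContinuousOn (fun z : ℝ => z * Real.log (z / c)) (Set.Icc c M) := by
    refine continuousOn_id.mul (ContinuousOn.log (by fun_prop) fun z hz => ?_)
    exact (div_pos (hc.trans_le hz.1) hc).ne'
  have hlog : 1 ≤ Real.log (M / c) := by
    rw [Real.le_log_iff_exp_le (div_pos (hc.trans_le hcM) hc), le_div_iff₀ hc]
    linarith
  have hbM : b ≤ M * Real.log (M / c) := by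
    have : b ≤ M := by nlinarith
    nlinarith
  obtain ⟨x, hx, hxb⟩ := intermediate_value_Icc hcM hcont
    (show b ∈ Set.Icc _ _ from ⟨by simpa [div_self hc.ne'] using hb.le, hbM⟩)
  refine ⟨x, lt_of_le_of_ne hx.1 ?_, hxb⟩
  rintro rfl
  simp [div_self hc.ne'] at hxb
  exact hb.ne hxb

/-- A solution of `s * log (s / (e * Δ)) = 2 * (T_AJ + y)` is the unique maximizer of the
capacity among positive arguments. -/
theorem Cap_lt_of_mul_log_div_eq {Δ T_AJ y s x : ℝ} (hΔ : 0 < Δ) (hA : 0 < T_AJ + y)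
    (hs : 0 < s) (hseq : s * Real.log (s / (Real.exp 1 * Δ)) = 2 * (T_AJ + y))
    (hx : 0 < x) (hxs : x ≠ s) : Cap Δ T_AJ x y < Cap Δ T_AJ s y := by
  have hlog : Real.log (s / (Real.exp 1 * Δ)) = Real.log (s / Δ) - 1 := by
    rw [mul_comm, ← div_div, Real.log_div (div_pos hs hΔ).ne' (Real.exp_ne_zero 1), Real.log_exp]
  rw [hlog] at hseq
  have hden : T_AJ + y + s / 2 = s * Real.log (s / Δ) / 2 := by linarith
  have hL : 0 < Real.log (s / Δ) := by
    by_contra! h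
    nlinarith
  have htangent : Real.log (x / Δ) < Real.log (s / Δ) - 1 + x / s := by
    have h := Real.log_lt_sub_one_of_pos (div_pos hx hs) (mt (div_eq_one_iff_eq hs.ne').1 hxs)
    rw [Real.log_div hx.ne' hs.ne'] at h
    rw [Real.log_div hx.ne' hΔ.ne', Real.log_div hs.ne' hΔ.ne']
    linarith
  have hmul : s * Real.log (x / Δ) < 2 * (T_AJ + y) + x := by
    have h := mul_lt_mul_of_pos_left htangent hs
    rwa [mul_add, hseq, mul_div_cancel₀ x hs.ne'] at h
  have hratio : Real.log (x / Δ) / (T_AJ + y + x / 2) <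
      Real.log (s / Δ) / (T_AJ + y + s / 2) := by
    rw [hden, div_lt_div_iff₀ (by positivity) (by positivity)]
    nlinarith
  unfold Cap Real.logb
  rw [div_right_comm, div_right_comm (Real.log (s / Δ))]
  exact div_lt_div_of_pos_right hratio (Real.log_pos one_lt_two)

/-- for each `y ≥ 0`: (i) there is a unique `x* > e·Δ` with
`x*·log(x*/(e·Δ)) = 2·(T_AJ + y)`; (ii) `x* > 2Δ`; (iii) `x*` is the unique maximizer of
`x ↦ C(x,y)` over `[2Δ, ∞)`.  (This `x*` is the best response `b_T(y)`.) -/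
theorem stmt_2 (Δ T_AJ : ℝ) (hΔ : 0 < Δ) (hT : 0 < T_AJ) (y : ℝ) (hy : 0 ≤ y) :
    ∃ xstar : ℝ,
      (Real.exp 1 * Δ < xstar ∧
        xstar * Real.log (xstar / (Real.exp 1 * Δ)) = 2 * (T_AJ + y)) ∧
      (∀ z : ℝ, Real.exp 1 * Δ < z →
        z * Real.log (z / (Real.exp 1 * Δ)) = 2 * (T_AJ + y) → z = xstar) ∧
      2 * Δ < xstar ∧
      (∀ x : ℝ, 2 * Δ ≤ x → x ≠ xstar → Cap Δ T_AJ x y < Cap Δ T_AJ xstar y) := by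
  have hc : 0 < Real.exp 1 * Δ := mul_pos (Real.exp_pos 1) hΔ
  have hA : 0 < T_AJ + y := by linarith
  have he : 2 < Real.exp 1 := by linarith [Real.exp_one_gt_d9]
  obtain ⟨s, hs, hseq⟩ := exists_mul_log_div_eq hc (mul_pos two_pos hA)
  refine ⟨s, ⟨hs, hseq⟩, fun z hz hzeq => ?_, ?_, fun x hx hxs => ?_⟩
  · exact (strictMonoOn_mul_log_div hc).injOn hz hs (hzeq.trans hseq.symm)
  · exact (mul_lt_mul_of_pos_right he hΔ).trans hs
  · exact Cap_lt_of_mul_log_div_eq hΔ hA (hc.trans hs) hseq (by linarith) hxs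
end

section
/- For each x ≥ 2Δ, the point y* := max(χ(x), 0) is the unique maximizer of y ↦ U_J(x,y) = −log₂(x/Δ)/(T_AJ + y + x/2) − c_T·P·y over [0, ∞), where χ(x) := √(log(x/Δ)/η) − T_AJ − x/2 and η := c_T·P·log 2. (This y* is the best response b_J(x) of the jammer.) -/
/-- The jammer's utility `U_J(x,y) = −C(x,y) − c_T·P·y`. -/
noncomputable def UJ (Δ T_AJ P c_T x y : ℝ) : ℝ := -(Cap Δ T_AJ x y) - c_T * P * y

/-- `χ(x) = √(log(x/Δ)/η) − T_AJ − x/2` with `η = c_T·P·log 2`. -/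
noncomputable def chi (Δ T_AJ P c_T x : ℝ) : ℝ :=
  Real.sqrt (Real.log (x / Δ) / (c_T * P * Real.log 2)) - T_AJ - x / 2

/-- On `[a, ∞)` with `a > 0`, the function `t ↦ s² / t + t` is uniquely minimized at `max s a`. -/
lemma sq_div_add_self_lt_of_ne_max {s a t : ℝ} (ha : 0 < a) (hs : 0 ≤ s) (hat : a ≤ t)
    (hne : t ≠ max s a) :
    s ^ 2 / max s a + max s a < s ^ 2 / t + t := by
  have ht : 0 < t := ha.trans_le hat
  have hu : 0 < max s a := ha.trans_le (le_max_right s a)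
  have key : 0 < (t - max s a) * (t * max s a - s ^ 2) := by
    rcases le_total a s with h | h
    · rw [max_eq_left h] at hne ⊢
      have : 0 < s * (t - s) ^ 2 :=
        mul_pos (ha.trans_le h) (by have := sub_ne_zero.2 hne; positivity)
      linarith
    · rw [max_eq_right h] at hne ⊢
      have hlt : a < t := lt_of_le_of_ne hat hne.symm
      exact mul_pos (sub_pos.2 hlt) (by nlinarith)
  have hdiff : s ^ 2 / t + t - (s ^ 2 / max s a + max s a)
      = (t - max s a) * (t * max s a - s ^ 2) / (t * max s a) := by
    field_simp
    ring
  have := div_pos key (mul_pos ht hu)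
  linarith

/-- for each `x ≥ 2Δ`, the point `y* = max(χ(x), 0)` is the unique maximizer
of `y ↦ U_J(x,y)` over `[0, ∞)`.  (This `y*` is the jammer's best response `b_J(x)`.) -/
theorem stmt_3 (Δ T_AJ P c_T : ℝ)
    (hΔ : 0 < Δ) (hT : 0 < T_AJ) (hP : 0 < P) (hc : 0 < c_T)
    (x : ℝ) (hx : 2 * Δ ≤ x) :
    ∀ y : ℝ, 0 ≤ y → y ≠ max (chi Δ T_AJ P c_T x) 0 →
      UJ Δ T_AJ P c_T x y < UJ Δ T_AJ P c_T x (max (chi Δ T_AJ P c_T x) 0) := by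
  intro y hy hne
  have hx0 : 0 < x := by linarith
  have hk : 0 < c_T * P := mul_pos hc hP
  have hlog2 : 0 < Real.log 2 := Real.log_pos one_lt_two
  have hlog : 0 ≤ Real.log (x / Δ) :=
    Real.log_nonneg ((one_le_div hΔ).2 (by linarith))
  set s := Real.sqrt (Real.log (x / Δ) / (c_T * P * Real.log 2)) with hs
  have hsq : s ^ 2 = Real.log (x / Δ) / (c_T * P * Real.log 2) :=
    Real.sq_sqrt (by positivity)
  have hU : ∀ z, UJ Δ T_AJ P c_T x z = c_T * P * (T_AJ + x / 2)
      - c_T * P * (s ^ 2 / (T_AJ + z + x / 2) + (T_AJ + z + x / 2)) := by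
    intro z
    have hL : Real.logb 2 (x / Δ) = c_T * P * s ^ 2 := by
      rw [hsq, Real.logb]
      field_simp
    rw [UJ, Cap, hL]
    ring
  have hmax : T_AJ + max (chi Δ T_AJ P c_T x) 0 + x / 2 = max s (T_AJ + x / 2) := by
    rw [chi, ← hs, add_right_comm, ← max_add_add_left]
    congr 1 <;> ring
  rw [hU, hU, hmax]
  have hmin := sq_div_add_self_lt_of_ne_max (s := s) (a := T_AJ + x / 2) (t := T_AJ + y + x / 2)
    (by linarith) (Real.sqrt_nonneg _) (by linarith) (fun h => hne (by linarith))
  have := mul_lt_mul_of_pos_left hmin hk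
  linarith
end

section
/- There exists a threshold c* > 0 (depending only on Δ, T_AJ and P) such that whenever c_T ≥ c*, one has χ(x) < 0 for every x ≥ 2Δ, where χ(x) := √(log(x/Δ)/(c_T·P·log 2)) − T_AJ − x/2; equivalently, for all such c_T the jammer's best response b_J(x) := max(χ(x), 0) vanishes identically on [2Δ, ∞). -/
/-- The jammer's best response `b_J(x) = max(χ(x), 0)`. -/
noncomputable def bJ (Δ T_AJ P c_T x : ℝ) : ℝ := max (chi Δ T_AJ P c_T x) 0

/-- there is a threshold `c* > 0` (depending only on `Δ`, `T_AJ`, `P`) such that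
whenever `c_T ≥ c*`, `χ(x) < 0` for every `x ≥ 2Δ`; equivalently, for all such `c_T` the
jammer's best response `b_J` vanishes identically on `[2Δ, ∞)`. -/
theorem stmt_4 (Δ T_AJ P : ℝ) (hΔ : 0 < Δ) (hT : 0 < T_AJ) (hP : 0 < P) :
    ∃ cstar : ℝ, 0 < cstar ∧
      ∀ c_T : ℝ, cstar ≤ c_T → ∀ x : ℝ, 2 * Δ ≤ x →
        chi Δ T_AJ P c_T x < 0 ∧ bJ Δ T_AJ P c_T x = 0 := by
  have hlog : 0 < Real.log 2 := Real.log_pos (by norm_num)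
  refine ⟨1 / (Δ * T_AJ * (P * Real.log 2)), by positivity, fun c_T hc x hx => ?_⟩
  have hx0 : 0 < x := by linarith
  have hη : 1 / (Δ * T_AJ) ≤ c_T * P * Real.log 2 := by
    rw [div_le_iff₀ (by positivity)] at hc ⊢
    linarith
  have hη0 : 0 < c_T * P * Real.log 2 := lt_of_lt_of_le (by positivity) hη
  have hlogx : Real.log (x / Δ) ≤ x / Δ := by
    linarith [Real.log_le_sub_one_of_pos (div_pos hx0 hΔ)]
  have hratio : Real.log (x / Δ) / (c_T * P * Real.log 2) ≤ T_AJ * x := by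
    rw [div_le_iff₀ hη0]
    calc Real.log (x / Δ) ≤ x / Δ := hlogx
      _ = T_AJ * x * (1 / (Δ * T_AJ)) := by field_simp
      _ ≤ T_AJ * x * (c_T * P * Real.log 2) := by gcongr
  have hsqrt : Real.sqrt (Real.log (x / Δ) / (c_T * P * Real.log 2)) < T_AJ + x / 2 := by
    rw [Real.sqrt_lt' (by positivity)]
    nlinarith [sq_pos_of_pos hT, sq_nonneg x]
  have hchi : chi Δ T_AJ P c_T x < 0 := by
    unfold chi
    linarith
  exact ⟨hchi, max_eq_right hchi.le⟩
end

section
/- The jamming game admits at least one Nash equilibrium: there exists a pair (x*, y*) with x* ≥ 2Δ and y* ≥ 0 such that C(x*, y*) ≥ C(x, y*) for all x ≥ 2Δ, and −C(x*, y*) − c_T·P·y* ≥ −C(x*, y) − c_T·P·y for all y ≥ 0. -/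
/-- The target node's utility `U_T(x,y) = C(x,y)`. -/
noncomputable def UT (Δ T_AJ x y : ℝ) : ℝ := Cap Δ T_AJ x y

/-- `(x*,y*) ∈ [2Δ,∞) × [0,∞)` is a Nash equilibrium of the jamming game. -/
def IsNE (Δ T_AJ P c_T xs ys : ℝ) : Prop :=
  2 * Δ ≤ xs ∧ 0 ≤ ys ∧
  (∀ x : ℝ, 2 * Δ ≤ x → UT Δ T_AJ x ys ≤ UT Δ T_AJ xs ys) ∧
  (∀ y : ℝ, 0 ≤ y → UJ Δ T_AJ P c_T xs y ≤ UJ Δ T_AJ P c_T xs ys)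

/-- If `T_AJ + y = x (log (x/Δ) - 1) / 2`, then `x` is a best response of the target node to `y`. -/
lemma UT_le_of_first_order {Δ T x y x' : ℝ} (hΔ : 0 < Δ) (hx : 0 < x) (hA : 0 < T + y)
    (h : T + y = x * (Real.log (x / Δ) - 1) / 2) (hx' : 0 < x') :
    UT Δ T x' y ≤ UT Δ T x y := by
  unfold UT Cap Real.logb
  have hl2 : 0 < Real.log 2 := Real.log_pos one_lt_two
  have hlog : Real.log (x' / Δ) ≤ Real.log (x / Δ) + (x' / x - 1) := by
    have h1 := Real.log_le_sub_one_of_pos (div_pos hx' hx)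
    rw [Real.log_div hx'.ne' hx.ne'] at h1
    rw [Real.log_div hx'.ne' hΔ.ne', Real.log_div hx.ne' hΔ.ne']
    linarith
  have hopt : Real.log (x / Δ) / Real.log 2 / (T + y + x / 2) = 2 / x / Real.log 2 := by
    have hD : T + y + x / 2 = x * Real.log (x / Δ) / 2 := by rw [h]; ring
    have hpos : 0 < x * Real.log (x / Δ) / 2 := by rw [← hD]; positivity
    have hl : Real.log (x / Δ) ≠ 0 := by
      intro h0
      simp [h0] at hpos
    rw [hD]
    field_simp
  rw [hopt, div_right_comm]
  refine div_le_div_of_nonneg_right ?_ hl2.le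
  rw [div_le_iff₀ (by positivity)]
  refine hlog.trans (le_of_eq ?_)
  rw [h]
  field_simp
  ring

/-- The first-order (complementarity) condition makes `y` a best response of the jammer to `x`. -/
lemma UJ_le_of_first_order {Δ T P c x y y' : ℝ} (hD : 0 < T + y + x / 2)
    (hD' : 0 < T + y' + x / 2) (hL : 0 ≤ Real.logb 2 (x / Δ))
    (h : 0 ≤ (c * P - Real.logb 2 (x / Δ) / (T + y + x / 2) ^ 2) * (y' - y)) :
    UJ Δ T P c x y' ≤ UJ Δ T P c x y := by
  unfold UJ Cap
  generalize Real.logb 2 (x / Δ) = L at *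
  have key : L / (T + y' + x / 2) - L / (T + y + x / 2) + L / (T + y + x / 2) ^ 2 * (y' - y)
      = L * (y' - y) ^ 2 / ((T + y' + x / 2) * (T + y + x / 2) ^ 2) := by
    have hy : y' - y = (T + y' + x / 2) - (T + y + x / 2) := by ring
    rw [hy]
    generalize T + y' + x / 2 = d' at *
    generalize T + y + x / 2 = d at *
    have := hD.ne'
    have := hD'.ne'
    field_simp
    ring
  have : 0 ≤ L * (y' - y) ^ 2 / ((T + y' + x / 2) * (T + y + x / 2) ^ 2) := by positivity
  linarith

/-- The first-order conditions in the coordinate `t = log (x/Δ)` yield an equilibrium. -/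
lemma isNE_of_first_order {Δ T P c t y : ℝ} (hΔ : 0 < Δ) (hT : 0 < T) (ht : 1 ≤ t) (hy : 0 ≤ y)
    (hA : T + y = Δ * Real.exp t * (t - 1) / 2)
    (hle : 4 ≤ c * P * Real.log 2 * Δ ^ 2 * Real.exp t ^ 2 * t)
    (hcompl : y = 0 ∨ c * P * Real.log 2 * Δ ^ 2 * Real.exp t ^ 2 * t = 4) :
    IsNE Δ T P c (Δ * Real.exp t) y := by
  have hl2 : 0 < Real.log 2 := Real.log_pos one_lt_two
  have hx : 0 < Δ * Real.exp t := by positivity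
  have hlog : Real.log (Δ * Real.exp t / Δ) = t := by
    rw [mul_div_cancel_left₀ _ hΔ.ne', Real.log_exp]
  have ht0 : 0 < t := by linarith
  have hD : T + y + Δ * Real.exp t / 2 = Δ * Real.exp t * t / 2 := by rw [hA]; ring
  refine ⟨?_, hy, fun x' hx' => ?_, fun y' hy' => ?_⟩
  · nlinarith [Real.add_one_le_exp t]
  · exact UT_le_of_first_order hΔ hx (by positivity) (by rw [hlog, hA]) (by linarith)
  · have hlogb : Real.logb 2 (Δ * Real.exp t / Δ) = t / Real.log 2 := by
      rw [Real.logb, hlog]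
    refine UJ_le_of_first_order (by positivity) (by positivity)
      (by rw [hlogb]; positivity) ?_
    have hgap : c * P - t / Real.log 2 / (Δ * Real.exp t * t / 2) ^ 2
        = (c * P * Real.log 2 * Δ ^ 2 * Real.exp t ^ 2 * t - 4)
          / (Real.log 2 * Δ ^ 2 * Real.exp t ^ 2 * t) := by
      field_simp
      ring
    rw [hlogb, hD, hgap]
    rcases hcompl with h | h
    · rw [h, sub_zero]
      exact mul_nonneg (div_nonneg (by linarith) (by positivity)) hy'
    · simp [h]

/-- the jamming game admits at least one Nash equilibrium. -/
theorem stmt_5 (Δ T_AJ P c_T : ℝ)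
    (hΔ : 0 < Δ) (hT : 0 < T_AJ) (hP : 0 < P) (hc : 0 < c_T) :
    ∃ xs ys : ℝ, IsNE Δ T_AJ P c_T xs ys := by
  have hl2 : 0 < Real.log 2 := Real.log_pos one_lt_two
  obtain ⟨t₀, ⟨ht₀, -⟩, h₀⟩ : ∃ t ∈ Set.Icc 1 (1 + 2 * T_AJ / Δ),
      Δ * Real.exp t * (t - 1) / 2 = T_AJ := by
    have hq : 0 < 2 * T_AJ / Δ := by positivity
    refine intermediate_value_Icc (f := fun t => Δ * Real.exp t * (t - 1) / 2)
      (by linarith) (by fun_prop) ⟨by simpa using hT.le, ?_⟩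
    have h1 : 1 ≤ Real.exp (1 + 2 * T_AJ / Δ) := Real.one_le_exp (by positivity)
    have h2 : Δ * Real.exp (1 + 2 * T_AJ / Δ) * (1 + 2 * T_AJ / Δ - 1) / 2
        = T_AJ * Real.exp (1 + 2 * T_AJ / Δ) := by
      field_simp
      ring
    simp only [h2]
    exact le_mul_of_one_le_right hT.le h1
  by_cases hle : 4 ≤ c_T * P * Real.log 2 * Δ ^ 2 * Real.exp t₀ ^ 2 * t₀
  · exact ⟨_, 0, isNE_of_first_order hΔ hT ht₀ le_rfl (by rw [h₀, add_zero]) hle (Or.inl rfl)⟩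
  · have hK : 0 < c_T * P * Real.log 2 * Δ ^ 2 := by positivity
    set K := c_T * P * Real.log 2 * Δ ^ 2 with hKdef
    have hq : 0 < 4 / K := by positivity
    obtain ⟨t, ⟨ht, -⟩, h⟩ : ∃ t ∈ Set.Icc t₀ (t₀ + 4 / K), K * Real.exp t ^ 2 * t = 4 := by
      refine intermediate_value_Icc (f := fun t => K * Real.exp t ^ 2 * t)
        (by linarith) (by fun_prop) ⟨(not_le.mp hle).le, ?_⟩
      have h1 : 1 ≤ Real.exp (t₀ + 4 / K) ^ 2 :=
        one_le_pow₀ (Real.one_le_exp (by linarith))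
      calc (4 : ℝ) = K * 1 * (4 / K) := by field_simp
        _ ≤ K * Real.exp (t₀ + 4 / K) ^ 2 * (t₀ + 4 / K) := by
          gcongr
          linarith
    have hmono : T_AJ ≤ Δ * Real.exp t * (t - 1) / 2 := by
      rw [← h₀]
      have : 0 ≤ t₀ - 1 := by linarith
      gcongr
    exact ⟨Δ * Real.exp t, Δ * Real.exp t * (t - 1) / 2 - T_AJ,
      isNE_of_first_order hΔ hT (ht₀.trans ht) (by linarith) (by ring) h.ge (Or.inr h)⟩
end

section
/- The jamming game admits at most one Nash equilibrium: if (x₁, y₁) and (x₂, y₂) are both pairs in [2Δ, ∞) × [0, ∞) such that each player's utility is maximized given the opponent's strategy, then (x₁, y₁) = (x₂, y₂). -/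
/-- At an equilibrium the target's strategy is interior and satisfies the first-order condition. -/
lemma IsNE.target_first_order {Δ T_AJ P c_T x y : ℝ} (hΔ : 0 < Δ) (hT : 0 < T_AJ)
    (h : IsNE Δ T_AJ P c_T x y) :
    2 * Δ < x ∧ x * (Real.log (x / Δ) - 1) = 2 * (T_AJ + y) := by
  obtain ⟨hx, hy, hmax, -⟩ := h
  simp only [UT, Cap] at hmax
  have hlt : 2 * Δ < x := by
    refine lt_of_le_of_ne hx ?_
    rintro rfl
    have h4 := hmax (4 * Δ) (by linarith)
    have e2 : Real.logb 2 (2 * Δ / Δ) = 1 := by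
      rw [mul_div_cancel_right₀ _ hΔ.ne']
      exact Real.logb_self_eq_one (by norm_num)
    have e4 : Real.logb 2 (4 * Δ / Δ) = 2 := by
      rw [mul_div_cancel_right₀ _ hΔ.ne', show (4 : ℝ) = 2 ^ (2 : ℝ) by norm_num]
      exact Real.logb_rpow (by norm_num) (by norm_num)
    rw [e2, e4, div_le_div_iff₀ (by positivity) (by positivity)] at h4
    linarith
  refine ⟨hlt, ?_⟩
  have hx0 : 0 < x := by linarith
  have hD : 0 < T_AJ + y + x / 2 := by positivity
  have hlog2 : 0 < Real.log 2 := Real.log_pos (by norm_num)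
  have hloc : IsLocalMax (fun z => Real.logb 2 (z / Δ) / (T_AJ + y + z / 2)) x := by
    filter_upwards [Ioi_mem_nhds hlt] with z hz
    exact hmax z (le_of_lt hz)
  have hnum : HasDerivAt (fun z => Real.logb 2 (z / Δ)) (1 / Δ / (x / Δ) / Real.log 2) x :=
    (((hasDerivAt_id x).div_const Δ).log (by simp [hx0.ne', hΔ.ne'])).div_const _
  have hden : HasDerivAt (fun z => T_AJ + y + z / 2) (1 / 2) x :=
    ((hasDerivAt_id x).div_const 2).const_add _
  have h0 := hloc.hasDerivAt_eq_zero (hnum.div hden hD.ne')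
  rw [div_eq_zero_iff, or_iff_left (by positivity), Real.logb] at h0
  field_simp at h0
  linarith

/-- The marginal gain of the jammer at an equilibrium is at most its marginal cost. -/
lemma IsNE.jammer_le {Δ T_AJ P c_T x y : ℝ} (hΔ : 0 < Δ) (hT : 0 < T_AJ)
    (hk : 0 < c_T * P) (h : IsNE Δ T_AJ P c_T x y) :
    Real.logb 2 (x / Δ) ≤ c_T * P * (T_AJ + y + x / 2) ^ 2 := by
  obtain ⟨hx, hy, -, hmax⟩ := h
  simp only [UJ, Cap] at hmax
  have hx0 : 0 < x := by linarith
  set k := c_T * P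
  set L := Real.logb 2 (x / Δ)
  set D := T_AJ + y + x / 2 with hDdef
  have hD : 0 < D := by positivity
  by_contra! hlt
  obtain ⟨s, hs⟩ : ∃ s, s = (L - k * D ^ 2) / (2 * (k * D)) := ⟨_, rfl⟩
  have hs0 : 0 < s := by rw [hs]; exact div_pos (by linarith) (by positivity)
  have hks : k * D * s = (L - k * D ^ 2) / 2 := by rw [hs]; field_simp
  have h1 := hmax (y + s) (by positivity)
  rw [show T_AJ + (y + s) + x / 2 = D + s by rw [hDdef]; ring] at h1
  have h2 : L / D - L / (D + s) = s * (L / (D * (D + s))) := by field_simp; ring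
  have h3 : L / (D * (D + s)) ≤ k := le_of_mul_le_mul_left (by linarith) hs0
  rw [div_le_iff₀ (by positivity)] at h3
  nlinarith

/-- If the jammer is active at an equilibrium, its marginal gain is at least its marginal cost. -/
lemma IsNE.jammer_ge {Δ T_AJ P c_T x y : ℝ} (hΔ : 0 < Δ) (hT : 0 < T_AJ)
    (hk : 0 < c_T * P) (hy : 0 < y) (h : IsNE Δ T_AJ P c_T x y) :
    c_T * P * (T_AJ + y + x / 2) ^ 2 ≤ Real.logb 2 (x / Δ) := by
  obtain ⟨hx, -, -, hmax⟩ := h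
  simp only [UJ, Cap] at hmax
  have hx0 : 0 < x := by linarith
  set k := c_T * P
  set L := Real.logb 2 (x / Δ)
  set D := T_AJ + y + x / 2 with hDdef
  have hD : 0 < D := by positivity
  by_contra! hlt
  obtain ⟨s, hs⟩ : ∃ s, s = min y ((k * D ^ 2 - L) / (2 * (k * D))) := ⟨_, rfl⟩
  have hs0 : 0 < s := by
    rw [hs]; exact lt_min hy (div_pos (by linarith) (by positivity))
  have hsy : s ≤ y := hs ▸ min_le_left _ _
  have hks : k * D * s ≤ (k * D ^ 2 - L) / 2 := by
    have : s ≤ (k * D ^ 2 - L) / (2 * (k * D)) := hs ▸ min_le_right _ _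
    rw [le_div_iff₀ (by positivity)] at this
    linarith
  have hDs : 0 < D - s := by rw [hDdef]; linarith
  have h1 := hmax (y - s) (by linarith)
  rw [show T_AJ + (y - s) + x / 2 = D - s by rw [hDdef]; ring] at h1
  have h2 : L / (D - s) - L / D = s * (L / (D * (D - s))) := by
    field_simp; ring
  have h3 : k ≤ L / (D * (D - s)) := le_of_mul_le_mul_left (by linarith) hs0
  rw [le_div_iff₀ (by positivity)] at h3
  nlinarith

/-- The jammer's strategy cannot be strictly larger at one equilibrium than at another. -/
lemma IsNE.jammer_strategy_le {Δ T_AJ P c_T x₁ y₁ x₂ y₂ : ℝ} (hΔ : 0 < Δ) (hT : 0 < T_AJ)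
    (hk : 0 < c_T * P) (h₁ : IsNE Δ T_AJ P c_T x₁ y₁) (h₂ : IsNE Δ T_AJ P c_T x₂ y₂) :
    y₂ ≤ y₁ := by
  by_contra! hlt
  have hy₁ : 0 ≤ y₁ := h₁.2.1
  obtain ⟨hx₁, e₁⟩ := h₁.target_first_order hΔ hT
  obtain ⟨hx₂, e₂⟩ := h₂.target_first_order hΔ hT
  have j₁ := h₁.jammer_le hΔ hT hk
  have j₂ := h₂.jammer_ge hΔ hT hk (by linarith)
  have p₁ : 0 < x₁ := by linarith
  have p₂ : 0 < x₂ := by linarith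
  have hlog2 : 0 < Real.log 2 := Real.log_pos (by norm_num)
  have l₁ : 0 < Real.log (x₁ / Δ) - 1 := pos_of_mul_pos_right (by rw [e₁]; linarith) p₁.le
  have hx : x₁ < x₂ := by
    by_contra! hle
    have : Real.log (x₂ / Δ) ≤ Real.log (x₁ / Δ) := Real.log_le_log (by positivity) (by gcongr)
    nlinarith
  have hl : Real.log (x₁ / Δ) < Real.log (x₂ / Δ) :=
    Real.log_lt_log (by positivity) (by gcongr)
  rw [show T_AJ + y₁ + x₁ / 2 = x₁ * Real.log (x₁ / Δ) / 2 by linarith, Real.logb,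
    div_le_iff₀ hlog2] at j₁
  rw [show T_AJ + y₂ + x₂ / 2 = x₂ * Real.log (x₂ / Δ) / 2 by linarith, Real.logb,
    le_div_iff₀ hlog2] at j₂
  generalize Real.log (x₁ / Δ) = a at *
  generalize Real.log (x₂ / Δ) = b at *
  have ha : 0 < a := by linarith
  have hb : 0 < b := by linarith
  have q₁ : 1 ≤ c_T * P * Real.log 2 / 4 * (x₁ ^ 2 * a) :=
    le_of_mul_le_mul_right (by linarith) ha
  have q₂ : c_T * P * Real.log 2 / 4 * (x₂ ^ 2 * b) ≤ 1 :=
    le_of_mul_le_mul_right (by linarith) hb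
  have : c_T * P * Real.log 2 / 4 * (x₁ ^ 2 * a) < c_T * P * Real.log 2 / 4 * (x₂ ^ 2 * b) := by
    gcongr
  linarith

/-- The target's best response is unique. -/
lemma IsNE.target_strategy_le {Δ T_AJ P c_T x₁ x₂ y : ℝ} (hΔ : 0 < Δ) (hT : 0 < T_AJ)
    (h₁ : IsNE Δ T_AJ P c_T x₁ y) (h₂ : IsNE Δ T_AJ P c_T x₂ y) : x₂ ≤ x₁ := by
  by_contra! hlt
  have hy : 0 ≤ y := h₁.2.1
  obtain ⟨hx₁, e₁⟩ := h₁.target_first_order hΔ hT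
  obtain ⟨hx₂, e₂⟩ := h₂.target_first_order hΔ hT
  have p₁ : 0 < x₁ := by linarith
  have l₁ : 0 < Real.log (x₁ / Δ) - 1 := pos_of_mul_pos_right (by rw [e₁]; linarith) p₁.le
  have hl : Real.log (x₁ / Δ) < Real.log (x₂ / Δ) :=
    Real.log_lt_log (by positivity) (by gcongr)
  nlinarith

/-- the jamming game admits at most one Nash equilibrium. -/
theorem stmt_6 (Δ T_AJ P c_T : ℝ)
    (hΔ : 0 < Δ) (hT : 0 < T_AJ) (hP : 0 < P) (hc : 0 < c_T)
    (x₁ y₁ x₂ y₂ : ℝ)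
    (h₁ : IsNE Δ T_AJ P c_T x₁ y₁) (h₂ : IsNE Δ T_AJ P c_T x₂ y₂) :
    x₁ = x₂ ∧ y₁ = y₂ := by
  have hk : 0 < c_T * P := mul_pos hc hP
  obtain rfl : y₁ = y₂ :=
    le_antisymm (h₂.jammer_strategy_le hΔ hT hk h₁) (h₁.jammer_strategy_le hΔ hT hk h₂)
  exact ⟨le_antisymm (h₂.target_strategy_le hΔ hT h₁) (h₁.target_strategy_le hΔ hT h₂), rfl⟩
end

section
/- Suppose x* > Δ satisfies η·x*²·log(x*/Δ) = 4 (with η := c_T·P·log 2), and set y* := (x*/2)·(log(x*/Δ) − 1) − T_AJ. If y* > 0, then x* > e·Δ > 2Δ and (x*, y*) is a Nash equilibrium of the jamming game (the interior Nash equilibrium). -/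
/-- The target's best response at `s`: the first-order condition
`T + y + s / 2 = s * log (s / Δ) / 2` makes the capacity maximal at `s`. -/
lemma cap_le_of_denominator_eq {Δ T y s x : ℝ} (hΔ : 0 < Δ) (hs : 0 < s) (hx : 0 < x)
    (hL : 0 < Real.log (s / Δ)) (hD : 0 < T + y + x / 2)
    (hDs : T + y + s / 2 = s * Real.log (s / Δ) / 2) :
    Cap Δ T x y ≤ Cap Δ T s y := by
  have hl2 : 0 < Real.log 2 := Real.log_pos one_lt_two
  have hlog : Real.log (x / Δ) ≤ Real.log (s / Δ) - 1 + x / s := by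
    have h := Real.log_le_sub_one_of_pos (div_pos hx hs)
    rw [Real.log_div hx.ne' hs.ne'] at h
    rw [Real.log_div hx.ne' hΔ.ne', Real.log_div hs.ne' hΔ.ne']
    linarith
  have hD' : T + y + x / 2 = s / 2 * (Real.log (s / Δ) - 1 + x / s) := by
    field_simp
    linarith
  have hval : Real.log (s / Δ) / Real.log 2 / (s * Real.log (s / Δ) / 2) =
      2 / s / Real.log 2 := by
    field_simp
  rw [Cap, Cap, Real.logb, Real.logb, hDs, hval, div_le_iff₀ hD, hD', div_mul_eq_mul_div]
  refine div_le_div_of_nonneg_right (hlog.trans_eq ?_) hl2.le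
  field_simp

/-- The tangent-line bound for `D ↦ K / D` at `E`. -/
lemma two_mul_div_le_div_add {K D E : ℝ} (hK : 0 ≤ K) (hD : 0 < D) (hE : 0 < E) :
    2 * K / E ≤ K / D + K / E ^ 2 * D := by
  have h : K / D + K / E ^ 2 * D - 2 * K / E = K * (D - E) ^ 2 / (D * E ^ 2) := by
    field_simp
    ring
  have : 0 ≤ K * (D - E) ^ 2 / (D * E ^ 2) := by positivity
  linarith

/-- if `x* > Δ` satisfies `η·x*²·log(x*/Δ) = 4` (with `η = c_T·P·log 2`) and
`y* := (x*/2)·(log(x*/Δ) − 1) − T_AJ > 0`, then `x* > e·Δ > 2Δ` and `(x*, y*)` is a Nash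
equilibrium of the jamming game (the interior Nash equilibrium). -/
theorem stmt_7 (Δ T_AJ P c_T η xstar : ℝ)
    (hΔ : 0 < Δ) (hT : 0 < T_AJ) (hP : 0 < P) (hc : 0 < c_T)
    (hη : η = c_T * P * Real.log 2)
    (hx : Δ < xstar)
    (heq : η * xstar ^ 2 * Real.log (xstar / Δ) = 4)
    (hy : 0 < xstar / 2 * (Real.log (xstar / Δ) - 1) - T_AJ) :
    Real.exp 1 * Δ < xstar ∧ 2 * Δ < Real.exp 1 * Δ ∧
    IsNE Δ T_AJ P c_T xstar (xstar / 2 * (Real.log (xstar / Δ) - 1) - T_AJ) := by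
  have hs : 0 < xstar := hΔ.trans hx
  have hl2 : 0 < Real.log 2 := Real.log_pos one_lt_two
  have hL : 1 < Real.log (xstar / Δ) := by
    by_contra! h
    nlinarith [mul_nonneg hs.le (sub_nonneg.2 h)]
  have he : 2 * Δ < Real.exp 1 * Δ :=
    mul_lt_mul_of_pos_right (by linarith [Real.exp_one_gt_d9]) hΔ
  have hex : Real.exp 1 * Δ < xstar :=
    (lt_div_iff₀ hΔ).1 ((Real.lt_log_iff_exp_lt (div_pos hs hΔ)).1 hL)
  have hDs : T_AJ + (xstar / 2 * (Real.log (xstar / Δ) - 1) - T_AJ) + xstar / 2 =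
      xstar * Real.log (xstar / Δ) / 2 := by ring
  refine ⟨hex, he, (he.trans hex).le, hy.le, fun x hx2 => ?_, fun y hy0 => ?_⟩
  · exact cap_le_of_denominator_eq hΔ hs (by linarith) (by linarith) (by linarith) hDs
  · have hprice : c_T * P =
        Real.logb 2 (xstar / Δ) / (xstar * Real.log (xstar / Δ) / 2) ^ 2 := by
      have hL0 : Real.log (xstar / Δ) ≠ 0 := by linarith
      rw [hη] at heq
      rw [Real.logb]
      field_simp
      linarith
    have hK : 0 ≤ Real.logb 2 (xstar / Δ) := by
      rw [Real.logb]
      exact div_nonneg (by linarith) hl2.le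
    have hDpos : 0 < xstar * Real.log (xstar / Δ) / 2 := by
      have := mul_pos hs (one_pos.trans hL)
      linarith
    have htangent := two_mul_div_le_div_add hK (show 0 < T_AJ + y + xstar / 2 by linarith) hDpos
    rw [← hprice] at htangent
    have hself : c_T * P * (xstar * Real.log (xstar / Δ) / 2) =
        Real.logb 2 (xstar / Δ) / (xstar * Real.log (xstar / Δ) / 2) := by
      rw [hprice]
      field_simp
    rw [← hDs] at htangent hself
    simp only [UJ, Cap]
    rw [mul_div_assoc] at htangent
    linarith
end

section
/- Let x* > Δ be the unique solution of η·x*²·log(x*/Δ) = 4 (with η := c_T·P·log 2). If (x*/2)·(log(x*/Δ) − 1) ≤ T_AJ, then the pair (x₀, 0) is a Nash equilibrium of the jamming game (a border equilibrium), where x₀ is the unique x > e·Δ satisfying x·log(x/(e·Δ)) = 2·T_AJ. -/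
/-- let `x* > Δ` be the unique solution of `η·x*²·log(x*/Δ) = 4`
(with `η = c_T·P·log 2`).  If `(x*/2)·(log(x*/Δ) − 1) ≤ T_AJ` then `(x₀, 0)` is a
Nash equilibrium (a border equilibrium), where `x₀` is the unique `x > e·Δ` with
`x·log(x/(e·Δ)) = 2·T_AJ`. -/
theorem stmt_8 (Δ T_AJ P c_T η xstar x₀ : ℝ)
    (hΔ : 0 < Δ) (hT : 0 < T_AJ) (hP : 0 < P) (hc : 0 < c_T)
    (hη : η = c_T * P * Real.log 2)
    (hx : Δ < xstar)
    (heq : η * xstar ^ 2 * Real.log (xstar / Δ) = 4)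
    (huniq : ∀ z : ℝ, Δ < z → η * z ^ 2 * Real.log (z / Δ) = 4 → z = xstar)
    (hborder : xstar / 2 * (Real.log (xstar / Δ) - 1) ≤ T_AJ)
    (hx₀ : Real.exp 1 * Δ < x₀)
    (hx₀eq : x₀ * Real.log (x₀ / (Real.exp 1 * Δ)) = 2 * T_AJ)
    (hx₀uniq : ∀ z : ℝ, Real.exp 1 * Δ < z →
      z * Real.log (z / (Real.exp 1 * Δ)) = 2 * T_AJ → z = x₀) :
    IsNE Δ T_AJ P c_T x₀ 0 := by
  have he : 2 < Real.exp 1 := by linarith [Real.exp_one_gt_d9]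
  have h2 : 2 * Δ < x₀ := lt_trans (mul_lt_mul_of_pos_right he hΔ) hx₀
  have hx₀_pos : 0 < x₀ := by linarith
  have hlog2 : 0 < Real.log 2 := Real.log_pos (by norm_num)
  have hL_eq : Real.log (x₀ / (Real.exp 1 * Δ)) = Real.log (x₀ / Δ) - 1 := by
    rw [Real.log_div hx₀_pos.ne' (by positivity), Real.log_mul (by positivity) hΔ.ne',
      Real.log_exp, Real.log_div hx₀_pos.ne' hΔ.ne']
    ring
  rw [hL_eq] at hx₀eq
  have hL : 1 < Real.log (x₀ / Δ) := by
    by_contra! h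
    nlinarith
  have hle : xstar ≤ x₀ := by
    by_contra! h
    have : Real.log (x₀ / Δ) < Real.log (xstar / Δ) :=
      Real.log_lt_log (by positivity) (by gcongr)
    nlinarith
  have hη_pos : 0 < η := by rw [hη]; positivity
  have hxstar_pos : 0 < xstar := hΔ.trans hx
  have hη_le : 4 ≤ η * x₀ ^ 2 * Real.log (x₀ / Δ) := by
    have : 0 ≤ Real.log (xstar / Δ) := Real.log_nonneg ((one_le_div hΔ).2 hx.le)
    rw [← heq]
    gcongr
  have hlog_le (x : ℝ) (hx : 0 < x) :
      Real.log (x / Δ) ≤ Real.log (x₀ / Δ) + (x / x₀ - 1) := by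
    have h := Real.log_le_sub_one_of_pos (div_pos hx hx₀_pos)
    rw [Real.log_div hx.ne' hx₀_pos.ne'] at h
    rw [Real.log_div hx.ne' hΔ.ne', Real.log_div hx₀_pos.ne' hΔ.ne']
    linarith
  set L := Real.log (x₀ / Δ) with hLdef
  have hD : T_AJ + x₀ / 2 = x₀ * L / 2 := by linarith
  refine ⟨h2.le, le_rfl, fun x hx2 => ?_, fun y hy => ?_⟩
  · have hx_pos : 0 < x := by linarith
    simp only [UT, Cap, Real.logb, ← hLdef, add_zero]
    rw [div_le_div_iff₀ (by positivity) (by positivity), div_mul_eq_mul_div, div_mul_eq_mul_div]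
    gcongr ?_ / _
    calc Real.log (x / Δ) * (T_AJ + x₀ / 2)
        ≤ (L + (x / x₀ - 1)) * (T_AJ + x₀ / 2) := by gcongr; exact hlog_le x hx_pos
      _ = L * (x₀ * (L - 1) / 2 + x / 2) := by rw [hD]; field_simp; ring
      _ = L * (T_AJ + x / 2) := by rw [hx₀eq]; ring
  · simp only [UJ, Cap, Real.logb, ← hLdef, add_zero, mul_zero, sub_zero]
    have hL_pos : 0 < L := by linarith
    rw [show T_AJ + y + x₀ / 2 = x₀ * L / 2 + y by linarith, hD]
    have key : L / (x₀ * L / 2) - L / (x₀ * L / 2 + y) ≤ η * y := by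
      rw [div_sub_div _ _ (by positivity) (by positivity), div_le_iff₀ (by positivity)]
      have h : L ≤ η * (x₀ * L / 2) ^ 2 := by nlinarith
      have hyy : 0 ≤ η * y * (x₀ * L / 2 * y) := by positivity
      nlinarith [mul_le_mul_of_nonneg_right h hy]
    have hdiv := div_le_div_of_nonneg_right key hlog2.le
    rw [sub_div, div_right_comm, div_right_comm L _ (Real.log 2),
      show η * y / Real.log 2 = c_T * P * y by rw [hη]; field_simp] at hdiv
    linarith
end

section
/- The target node's best response function b_T, defined on [0, ∞) by letting b_T(y) be the unique x > e·Δ with x·log(x/(e·Δ)) = 2·(T_AJ + y), is differentiable with derivative b_T′(y) = 2/log(b_T(y)/Δ) for every y ≥ 0; in particular b_T is strictly increasing on [0, ∞). -/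
open Filter Topology in
/-- A one-sided version of `HasDerivAt.of_local_left_inverse`. -/
lemma HasDerivAt.hasDerivWithinAt_of_leftInvOn {f g : ℝ → ℝ} {s : Set ℝ} {f' a : ℝ}
    (hg : ContinuousWithinAt g s a) (hf : HasDerivAt f f' (g a)) (hf' : f' ≠ 0) (ha : a ∈ s)
    (hfg : Set.LeftInvOn f g s) : HasDerivWithinAt g f'⁻¹ s a := by
  have hg' : Tendsto g (𝓝[s] a) (𝓝[Set.univ] (g a)) := by
    rw [nhdsWithin_univ]
    exact hg
  exact ((hf.hasFDerivAt_equiv hf').hasFDerivWithinAt (s := Set.univ)).of_local_left_inverse hg' ha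
    (eventually_mem_nhdsWithin.mono fun _ hx => hfg hx)

/-- Beyond `c`, the function `x ↦ x * log (x / c)` expands distances. -/
lemma sub_le_mul_log_div_sub_mul_log_div {a b c : ℝ} (hc : 0 < c) (hca : c ≤ a) (hab : a ≤ b) :
    b - a ≤ b * Real.log (b / c) - a * Real.log (a / c) := by
  have ha : 0 < a := hc.trans_le hca
  have hb : 0 < b := ha.trans_le hab
  have hlog : 0 ≤ Real.log (a / c) := Real.log_nonneg ((one_le_div hc).2 hca)
  have hsplit : Real.log (b / c) = Real.log (b / a) + Real.log (a / c) := by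
    rw [← Real.log_mul (by positivity) (by positivity)]
    congr 1
    field_simp
  have hba : b - a ≤ b * Real.log (b / a) := by
    calc b - a = b * (1 - (b / a)⁻¹) := by field_simp
      _ ≤ b * Real.log (b / a) :=
        mul_le_mul_of_nonneg_left (Real.one_sub_inv_le_log_of_pos (by positivity)) hb.le
  rw [hsplit]
  nlinarith [mul_nonneg (sub_nonneg.2 hab) hlog]

lemma hasDerivAt_mul_log_div {c x : ℝ} (hc : c ≠ 0) (hx : x ≠ 0) :
    HasDerivAt (fun t => t * Real.log (t / c)) (Real.log (x / c) + 1) x := by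
  have h := (hasDerivAt_id x).mul
    (((hasDerivAt_id x).div_const c).log (div_ne_zero hx hc))
  refine h.congr_deriv ?_
  simp only [id]
  field_simp

/-- the target node's best response `b_T` — defined on `[0, ∞)` by letting
`b_T(y)` be the unique `x > e·Δ` with `x·log(x/(e·Δ)) = 2·(T_AJ + y)` — is differentiable
with derivative `b_T′(y) = 2/log(b_T(y)/Δ)` for every `y ≥ 0`; in particular `b_T` is
strictly increasing on `[0, ∞)`. -/
theorem stmt_9 (Δ T_AJ : ℝ) (hΔ : 0 < Δ) (hT : 0 < T_AJ)
    (bT : ℝ → ℝ)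
    (hbT : ∀ y : ℝ, 0 ≤ y → Real.exp 1 * Δ < bT y ∧
      bT y * Real.log (bT y / (Real.exp 1 * Δ)) = 2 * (T_AJ + y))
    (hbTuniq : ∀ y : ℝ, 0 ≤ y → ∀ z : ℝ, Real.exp 1 * Δ < z →
      z * Real.log (z / (Real.exp 1 * Δ)) = 2 * (T_AJ + y) → z = bT y) :
    (∀ y : ℝ, 0 ≤ y →
      HasDerivWithinAt bT (2 / Real.log (bT y / Δ)) (Set.Ici 0) y) ∧
    StrictMonoOn bT (Set.Ici 0) := by
  have hc : 0 < Real.exp 1 * Δ := by positivity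
  have hmono : StrictMonoOn bT (Set.Ici 0) := by
    intro y hy z hz hyz
    by_contra! hle
    have h := sub_le_mul_log_div_sub_mul_log_div hc (hbT z hz).1.le hle
    rw [(hbT y hy).2, (hbT z hz).2] at h
    linarith
  have hexpand : ∀ y ∈ Set.Ici (0 : ℝ), ∀ z ∈ Set.Ici (0 : ℝ), bT y ≤ bT z + 2 * dist y z := by
    intro y hy z hz
    rcases le_total y z with hyz | hzy
    · linarith [hmono.monotoneOn hy hz hyz, dist_nonneg (x := y) (y := z)]
    · have h := sub_le_mul_log_div_sub_mul_log_div hc (hbT z hz).1.le (hmono.monotoneOn hz hy hzy)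
      rw [(hbT y hy).2, (hbT z hz).2] at h
      rw [Real.dist_eq]
      linarith [le_abs_self (y - z)]
  have hcont : ContinuousOn bT (Set.Ici 0) :=
    (LipschitzOnWith.of_le_add_mul 2 hexpand).continuousOn
  refine ⟨fun y hy => ?_, hmono⟩
  obtain ⟨hlt, -⟩ := hbT y hy
  have hpos : 0 < bT y := hc.trans hlt
  have hlog : Real.log (bT y / (Real.exp 1 * Δ)) + 1 = Real.log (bT y / Δ) := by
    rw [Real.log_div hpos.ne' hc.ne', Real.log_mul (Real.exp_ne_zero 1) hΔ.ne', Real.log_exp,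
      Real.log_div hpos.ne' hΔ.ne']
    ring
  have hlogpos : 0 < Real.log (bT y / Δ) := by
    rw [← hlog]
    linarith [Real.log_pos ((one_lt_div hc).2 hlt)]
  have hderiv := ((hasDerivAt_mul_log_div hc.ne' hpos.ne').div_const 2).sub_const T_AJ
  rw [hlog] at hderiv
  have h := hderiv.hasDerivWithinAt_of_leftInvOn (hcont y hy) (by positivity) hy
    fun z hz => by linarith [(hbT z hz).2]
  rwa [inv_div] at h
end

section
/- Let 0 < ξ_min < ξ_max, let ξ ∈ [ξ_min, ξ_max], and let g > Δ be a real number satisfying √(log(g/Δ)/(ξ·P·log 2)) = T_AJ + g/2 (i.e., g is the leader strategy making χ vanish when the jammer's weight equals ξ). Then the expected utility of the target node under a uniform distribution of the jammer's weight on [ξ_min, ξ_max], namely (1/(ξ_max − ξ_min))·( ∫_{ξ_min}^{ξ} √(α·P·log₂(g/Δ)) dα + ∫_{ξ}^{ξ_max} log₂(g/Δ)/(T_AJ + g/2) dα ), equals P·(T_AJ + g/2)·( ξ·ξ_max − ξ²/3 − (2/3)·√ξ·ξ_min^{3/2} )/(ξ_max − ξ_min). -/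
/-- The integral of the square root over an interval with nonnegative endpoints. -/
lemma integral_sqrt_of_nonneg {a b : ℝ} (ha : 0 ≤ a) (hb : 0 ≤ b) :
    ∫ x in a..b, Real.sqrt x = 2 / 3 * (b * Real.sqrt b - a * Real.sqrt a) := by
  have rpow_eq (x : ℝ) (hx : 0 ≤ x) : x ^ ((1 / 2 : ℝ) + 1) = x * Real.sqrt x := by
    rw [Real.rpow_add_one' hx (by norm_num), Real.sqrt_eq_rpow, mul_comm]
  simp_rw [Real.sqrt_eq_rpow]
  rw [integral_rpow (Or.inl (by norm_num)), rpow_eq a ha, rpow_eq b hb]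
  simp_rw [Real.sqrt_eq_rpow]
  ring

/-- let `0 < ξ_min < ξ_max`, `ξ ∈ [ξ_min, ξ_max]`, and let `g > Δ` satisfy
`√(log(g/Δ)/(ξ·P·log 2)) = T_AJ + g/2`.  Then the expected utility of the target node
under a uniform distribution of the jammer's weight on `[ξ_min, ξ_max]`, namely
`(1/(ξ_max − ξ_min))·(∫_{ξ_min}^{ξ} √(α·P·log₂(g/Δ)) dα + ∫_{ξ}^{ξ_max} log₂(g/Δ)/(T_AJ + g/2) dα)`,
equals `P·(T_AJ + g/2)·(ξ·ξ_max − ξ²/3 − (2/3)·√ξ·ξ_min^{3/2})/(ξ_max − ξ_min)`. -/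
theorem stmt_19 (Δ T_AJ P : ℝ) (hΔ : 0 < Δ) (hT : 0 < T_AJ) (hP : 0 < P)
    (ξmin ξmax ξ g : ℝ)
    (hmin : 0 < ξmin) (hminmax : ξmin < ξmax)
    (hξ₁ : ξmin ≤ ξ) (hξ₂ : ξ ≤ ξmax)
    (hg : Δ < g)
    (heq : Real.sqrt (Real.log (g / Δ) / (ξ * P * Real.log 2)) = T_AJ + g / 2) :
    1 / (ξmax - ξmin) *
      ((∫ α in ξmin..ξ, Real.sqrt (α * P * Real.logb 2 (g / Δ))) +
       (∫ α in ξ..ξmax, Real.logb 2 (g / Δ) / (T_AJ + g / 2))) =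
    P * (T_AJ + g / 2) *
      (ξ * ξmax - ξ ^ 2 / 3 - 2 / 3 * Real.sqrt ξ * (ξmin * Real.sqrt ξmin)) /
      (ξmax - ξmin) := by
  have hξ : 0 < ξ := hmin.trans_le hξ₁
  have hlog2 : 0 < Real.log 2 := Real.log_pos one_lt_two
  have hS : 0 < T_AJ + g / 2 := by linarith
  set S := T_AJ + g / 2
  have hL : Real.logb 2 (g / Δ) = ξ * P * S ^ 2 := by
    have hlog : 0 ≤ Real.log (g / Δ) := Real.log_nonneg ((one_le_div hΔ).2 hg.le)
    have hsq := Real.sq_sqrt (show 0 ≤ Real.log (g / Δ) / (ξ * P * Real.log 2) by positivity)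
    rw [heq] at hsq
    rw [hsq, Real.logb]
    field_simp
  have hsqrt (α : ℝ) : Real.sqrt (α * P * (ξ * P * S ^ 2)) =
      P * S * Real.sqrt ξ * Real.sqrt α := by
    rw [show α * P * (ξ * P * S ^ 2) = (P * S) ^ 2 * (ξ * α) by ring,
      Real.sqrt_mul (by positivity), Real.sqrt_sq (by positivity), Real.sqrt_mul hξ.le]
    ring
  have hdiv : ξ * P * S ^ 2 / S = ξ * P * S := by field_simp
  simp_rw [hL, hsqrt, hdiv]
  rw [intervalIntegral.integral_const_mul, integral_sqrt_of_nonneg hmin.le hξ.le,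
    intervalIntegral.integral_const, smul_eq_mul, one_div_mul_eq_div]
  congr 1
  linear_combination 2 / 3 * P * S * ξ * Real.mul_self_sqrt hξ.le
end
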